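/- Let n, m > 1 and let M be a pointwise finite-dimensional, weakly exact, indecomposable persistence module over the finite grid [1,n] × [1,m] that is not isomorphic to a rectangle module. Then the vector spaces M_{(1,1)} and M_{(n,m)} are both zero. -/

import Mathlib

open CategoryTheory Limits Set

noncomputable section

set_option linter.unusedSectionVars false

attribute [local instance] Classical.propDecidable

namespace PersistencePaper

/-- A persistence module over a poset `P`, with coefficients in a field `k`:
a functor from `P` (viewed as a category) to the category of `k`-vector spaces. -/
abbrev PersistenceModule (k : Type) [Field k] (P : Type) [Preorder P] : Type 1 :=
  P ⥤ ModuleCat k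

variable (k : Type) [Field k]

section Indicator

variable {P : Type} [Preorder P]

/-- The fiber of the indicator module of a set `Q ⊆ P` at a point `t : P`,
realized as a submodule of `k`: it is all of `k` when `t ∈ Q` and `0` otherwise. -/
def indSub (Q : Set P) (t : P) : Submodule k k where
  carrier := {x | t ∉ Q → x = 0}
  add_mem' := by intro a b ha hb ht; rw [ha ht, hb ht, add_zero]
  zero_mem' := fun _ => rfl
  smul_mem' := by intro c x hx ht; rw [hx ht, smul_zero]

/-- The structure map of the indicator module: the identity when both endpoints lie in
`Q`, and zero otherwise. -/
def indMap (Q : Set P) (s t : P) : indSub k Q s →ₗ[k] indSub k Q t where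
  toFun x := ⟨if s ∈ Q ∧ t ∈ Q then (x : k) else 0, by
    intro ht
    split_ifs with h
    · exact absurd h.2 ht
    · rfl⟩
  map_add' x y := by apply Subtype.ext; split_ifs <;> simp
  map_smul' c x := by apply Subtype.ext; split_ifs <;> simp

theorem indMap_coe (Q : Set P) (s t : P) (x : indSub k Q s) :
    (indMap k Q s t x : k) = if s ∈ Q ∧ t ∈ Q then (x : k) else 0 := rfl

/-- The indicator persistence module `k_Q` of a convex subset `Q` of a poset `P`:
it assigns `k` to points of `Q` and `0` elsewhere, the structure maps being the identity
between points of `Q` and zero otherwise. -/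
def indicator (Q : Set P) (hQ : Q.OrdConnected) : PersistenceModule k P where
  obj t := ModuleCat.of k (indSub k Q t)
  map {s t} _ := ModuleCat.ofHom (indMap k Q s t)
  map_id t := by
    refine ModuleCat.hom_ext <| LinearMap.ext fun x => Subtype.ext ?_
    show (indMap k Q t t x).val = Subtype.val x
    rw [indMap_coe]
    split_ifs with h
    · rfl
    · exact (x.2 fun ht => h ⟨ht, ht⟩).symm
  map_comp {s t u} f g := by
    refine ModuleCat.hom_ext <| LinearMap.ext fun x => Subtype.ext ?_
    show (indMap k Q s u x).val = (indMap k Q t u (indMap k Q s t x)).val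
    rw [indMap_coe, indMap_coe, indMap_coe]
    by_cases hs : s ∈ Q <;> by_cases hu : u ∈ Q
    · have ht : t ∈ Q := hQ.out hs hu ⟨leOfHom f, leOfHom g⟩
      simp [hs, ht, hu]
    · simp [hs, hu]
    · simp [hs, hu]
    · simp [hs, hu]

/-- The structure map `ρ_s^t : M_s → M_t` of a persistence module, as a linear map. -/
def rho (M : PersistenceModule k P) {s t : P} (h : s ≤ t) : M.obj s →ₗ[k] M.obj t :=
  (M.map (homOfLE h)).hom

/-- The rank invariant `r(s,t)` of a persistence module: the rank of `ρ_s^t` when `s ≤ t`,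
and `0` (by convention) otherwise. -/
def rk (M : PersistenceModule k P) (s t : P) : ℕ :=
  if h : s ≤ t then Module.finrank k (LinearMap.range (rho k M h)) else 0

/-- A persistence module is pointwise finite-dimensional (pfd) if all its spaces are
finite-dimensional. -/
def Pfd (M : PersistenceModule k P) : Prop :=
  ∀ t : P, FiniteDimensional k (M.obj t)

/-- An interval of a poset: a nonempty, convex and zigzag-connected subset. -/
def IsInterval (Q : Set P) : Prop :=
  Q.Nonempty ∧ Q.OrdConnected ∧
    ∀ p ∈ Q, ∀ q ∈ Q,
      Relation.ReflTransGen (fun a b => a ∈ Q ∧ b ∈ Q ∧ (a ≤ b ∨ b ≤ a)) p q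

/-- A persistence module is interval-decomposable if it is isomorphic to a direct sum
of indicator modules of intervals. -/
def IntervalDecomposable (M : PersistenceModule k P) : Prop :=
  ∃ (ι : Type) (I : ι → Set P) (hI : ∀ i, IsInterval (I i)),
    Nonempty (M ≅ ∐ fun i => indicator k (I i) (hI i).2.1)

end Indicator

section Rect

variable {X Y : Type} [Preorder X] [Preorder Y]

/-- A rectangle in the product poset `X × Y`: a nonempty product `I ×ˢ J` of an
interval (convex subset) of `X` with an interval of `Y`. -/
def IsRectangle (R : Set (X × Y)) : Prop :=
  R.Nonempty ∧ ∃ (I : Set X) (J : Set Y), I.OrdConnected ∧ J.OrdConnected ∧ R = I ×ˢ J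

theorem IsRectangle.ordConnected {R : Set (X × Y)} (h : IsRectangle R) :
    R.OrdConnected := by
  obtain ⟨-, I, J, hI, hJ, rfl⟩ := h
  constructor
  intro x hx y hy z hz
  exact ⟨hI.out hx.1 hy.1 ⟨hz.1.1, hz.2.1⟩, hJ.out hx.2 hy.2 ⟨hz.1.2, hz.2.2⟩⟩

/-- A persistence bimodule is rectangle-decomposable if it is isomorphic to a direct sum
of indicator (rectangle) modules of rectangles. -/
def RectangleDecomposable (M : PersistenceModule k (X × Y)) : Prop :=
  ∃ (ι : Type) (R : ι → Set (X × Y)) (hR : ∀ i, IsRectangle (R i)),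
    Nonempty (M ≅ ∐ fun i => indicator k (R i) (hR i).ordConnected)

/-- A persistence bimodule `M` over `X × Y` is weakly exact if for all `s ≤ t`,
`Im ρ_s^t = Im ρ_{(t₁,s₂)}^t ∩ Im ρ_{(s₁,t₂)}^t` and
`Ker ρ_s^t = Ker ρ_s^{(t₁,s₂)} + Ker ρ_s^{(s₁,t₂)}`. -/
def WeaklyExact (M : PersistenceModule k (X × Y)) : Prop :=
  ∀ (s t : X × Y) (h : s ≤ t),
    (LinearMap.range (rho k M h) =
        LinearMap.range (rho k M (show (t.1, s.2) ≤ t from ⟨le_refl t.1, h.2⟩)) ⊓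
        LinearMap.range (rho k M (show (s.1, t.2) ≤ t from ⟨h.1, le_refl t.2⟩))) ∧
    (LinearMap.ker (rho k M h) =
        LinearMap.ker (rho k M (show s ≤ (t.1, s.2) from ⟨h.1, le_refl s.2⟩)) ⊔
        LinearMap.ker (rho k M (show s ≤ (s.1, t.2) from ⟨le_refl s.1, h.2⟩)))

/-- The space (fiber) of a persistence module at an index. -/
abbrev fiber {k : Type} [Field k] {P : Type} [Preorder P]
    (M : PersistenceModule k P) (t : P) : ModuleCat k :=
  M.obj t

/-- Morphisms of persistence modules (natural transformations). -/
abbrev PMHom {k : Type} [Field k] {P : Type} [Preorder P]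
    (M N : PersistenceModule k P) : Type :=
  M ⟶ N

/-- The component of a morphism of persistence modules at an index, as a linear map. -/
abbrev PMHom.appLin {k : Type} [Field k] {P : Type} [Preorder P]
    {M N : PersistenceModule k P} (f : PMHom M N) (t : P) :
    M.obj t →ₗ[k] N.obj t :=
  (f.app t).hom

/-- The restriction of a persistence module to a subset of its indexing poset. -/
def restrict {P : Type} [Preorder P] (M : PersistenceModule k P) (S : Set P) :
    PersistenceModule k ↥S :=
  (show Monotone (Subtype.val : ↥S → P) from fun _ _ h => h).functor ⋙ M

/-- The pullback (restriction) of a persistence module along a monotone map of posets. -/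
def restrictAlong {P R : Type} [Preorder P] [Preorder R] {f : R → P} (hf : Monotone f)
    (M : PersistenceModule k P) : PersistenceModule k R :=
  hf.functor ⋙ M

/-- The right Kan extension of a persistence module along a monotone map of posets. -/
def ranAlong {P R : Type} [Preorder P] [Preorder R] {f : P → R} (hf : Monotone f)
    (M : PersistenceModule k P) : PersistenceModule k R :=
  hf.functor.ran.obj M

/-- `M` decomposes as a direct sum of indicator modules whose supports are drawn from
the family `A` of (convex) subsets of the indexing poset. -/
def DecomposesWithSupports {P : Type} [Preorder P] (M : PersistenceModule k P)
    (A : Set (Set P)) : Prop :=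
  ∃ (ι : Type) (Q : ι → Set P) (_ : ∀ i, Q i ∈ A) (hconv : ∀ i, (Q i).OrdConnected),
    Nonempty (M ≅ ∐ fun i => indicator k (Q i) (hconv i))

end Rect

end PersistencePaper
namespace PersistencePaper

/-- A persistence module is indecomposable if it is nonzero and in any direct sum
decomposition one of the two summands is zero. -/
def Indecomposable {k : Type} [Field k] {P : Type} [Preorder P]
    (M : PersistenceModule k P) : Prop :=
  (¬ ∀ t : P, Subsingleton (M.obj t)) ∧
    ∀ A B : PersistenceModule k P, Nonempty (M ≅ (A ⨿ B : PersistenceModule k P)) →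
      (∀ t : P, Subsingleton (A.obj t)) ∨ (∀ t : P, Subsingleton (B.obj t))

section Aux

theorem rho_comp {k : Type} [Field k] {P : Type} [Preorder P] (M : PersistenceModule k P)
    {a b c : P} (h : a ≤ b) (h' : b ≤ c) (x : M.obj a) :
    rho k M h' (rho k M h x) = rho k M (h.trans h') x := by
  unfold rho
  rw [← LinearMap.comp_apply, ← ModuleCat.hom_comp, ← M.map_comp]
  rfl

theorem rho_refl {k : Type} [Field k] {P : Type} [Preorder P] (M : PersistenceModule k P)
    {a : P} (h : a ≤ a) (x : M.obj a) : rho k M h x = x := by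
  unfold rho
  have : homOfLE h = 𝟙 a := rfl
  rw [this, M.map_id]
  rfl

theorem iso_of_retract {k : Type} [Field k] {P : Type} [Preorder P]
    {M N : PersistenceModule k P} (hM : Indecomposable M)
    (i : N ⟶ M) (p : M ⟶ N) (hip : i ≫ p = 𝟙 N) (hN : ¬ ∀ t : P, Subsingleton (N.obj t)) :
    Nonempty (M ≅ N) := by
  have : IsSplitMono i := IsSplitMono.mk' ⟨p, hip⟩
  have hb := isBilimitBinaryBiconeOfIsSplitMonoOfCokernel (f := i) (cokernelIsCokernel i)
  have e : M ≅ N ⨿ cokernel i :=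
    hb.isColimit.coconePointUniqueUpToIso (colimit.isColimit _)
  rcases hM.2 _ _ ⟨e⟩ with h | h
  · exact absurd h hN
  · have hz : i ≫ (p ≫ i - 𝟙 M) = 0 := by
      rw [Preadditive.comp_sub, ← Category.assoc, hip]; simp
    have h1 : cokernel.desc i _ hz = 0 := by
      ext t x
      have := h t
      have hx : x = 0 := Subsingleton.elim _ _
      rw [hx]; simp
    have h2 := cokernel.π_desc i _ hz
    rw [h1, comp_zero] at h2
    exact ⟨⟨p, i, (sub_eq_zero.mp h2.symm), hip⟩⟩

theorem iso_of_pair {k : Type} [Field k] {P : Type} [Preorder P]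
    {M : PersistenceModule k P} (hM : Indecomposable M)
    (p q : P) (hpq : p ≤ q) (y : M.obj p) (φ : M.obj q →ₗ[k] k)
    (h1 : ∀ t (ht : p ≤ t), ¬ t ≤ q → rho k M ht y = 0)
    (h2 : ∀ t (ht : t ≤ q), ¬ p ≤ t → ∀ v, φ (rho k M ht v) = 0)
    (h3 : φ (rho k M hpq y) = 1) (R : Set P) (hR : R.OrdConnected)
    (hRe : ∀ t, t ∈ R ↔ p ≤ t ∧ t ≤ q) :
    Nonempty (M ≅ indicator k R hR) := by
  let i : indicator k R hR ⟶ M :=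
    { app := fun t => ModuleCat.ofHom
        (if h : p ≤ t then
          (LinearMap.toSpanSingleton k (M.obj t) (rho k M h y)).comp (indSub k R t).subtype
         else 0)
      naturality := by
        intro s t f
        have hst : s ≤ t := leOfHom f
        refine ModuleCat.hom_ext <| LinearMap.ext fun (x : indSub k R s) => ?_
        show (dite (p ≤ t) _ _ : indSub k R t →ₗ[k] M.obj t) (indMap k R s t x)
          = rho k M hst ((dite (p ≤ s) _ _ : indSub k R s →ₗ[k] M.obj s) x)
        by_cases hs : s ∈ R
        · have hps := ((hRe s).1 hs).1
          have hpt := hps.trans hst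
          rw [dif_pos hps, dif_pos hpt]
          simp only [LinearMap.comp_apply, LinearMap.toSpanSingleton_apply,
            Submodule.subtype_apply, map_smul, rho_comp, indMap_coe]
          by_cases ht : t ∈ R
          · simp [hs, ht]
          · have : ¬ t ≤ q := fun h => ht ((hRe t).2 ⟨hpt, h⟩)
            rw [h1 t hpt this]; simp
        · have : x = 0 := Subtype.ext (x.2 hs)
          rw [this]; simp only [map_zero] }
  let r : M ⟶ indicator k R hR :=
    { app := fun t => ModuleCat.ofHom
        (LinearMap.codRestrict (indSub k R t)
          (if h : t ≤ q then φ.comp (rho k M h) else 0) (by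
            intro v ht
            split_ifs with h
            · exact h2 t h (fun h' => ht ((hRe t).2 ⟨h', h⟩)) v
            · rfl))
      naturality := by
        intro s t f
        have hst : s ≤ t := leOfHom f
        refine ModuleCat.hom_ext <| LinearMap.ext fun (x : M.obj s) => Subtype.ext ?_
        show (dite (t ≤ q) _ _ : M.obj t →ₗ[k] k) (rho k M hst x)
          = if s ∈ R ∧ t ∈ R then (dite (s ≤ q) _ _ : M.obj s →ₗ[k] k) x else 0
        by_cases ht : t ≤ q
        · have hs := hst.trans ht
          rw [dif_pos ht, dif_pos hs]
          simp only [LinearMap.comp_apply, rho_comp]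
          by_cases hsR : p ≤ s
          · rw [if_pos ⟨(hRe s).2 ⟨hsR, hs⟩, (hRe t).2 ⟨hsR.trans hst, ht⟩⟩]
          · rw [if_neg (fun h => hsR ((hRe s).1 h.1).1)]
            exact h2 s hs hsR x
        · rw [dif_neg ht, if_neg (fun h => ht ((hRe t).1 h.2).2)]; rfl }
  refine iso_of_retract hM i r ?_ ?_
  · ext t : 2
    refine ModuleCat.hom_ext <| LinearMap.ext fun (x : indSub k R t) => Subtype.ext ?_
    show (dite (t ≤ q) _ _ : M.obj t →ₗ[k] k)
        ((dite (p ≤ t) _ _ : indSub k R t →ₗ[k] M.obj t) x) = (x : k)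
    by_cases ht : t ∈ R
    · obtain ⟨ha, hb⟩ := (hRe t).1 ht
      rw [dif_pos ha, dif_pos hb]
      simp only [LinearMap.comp_apply, LinearMap.toSpanSingleton_apply,
            Submodule.subtype_apply, map_smul, rho_comp, h3]
      simp
    · have : x = 0 := Subtype.ext (x.2 ht)
      rw [this]; simp only [map_zero]; rfl
  · intro h
    have hp : p ∈ R := (hRe p).2 ⟨le_refl _, hpq⟩
    have : Subsingleton (indSub k R p) := h p
    have h01 : (⟨0, fun _ => rfl⟩ : indSub k R p) = ⟨1, fun h => absurd hp h⟩ :=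
      Subsingleton.elim _ _
    exact zero_ne_one (congrArg Subtype.val h01)

theorem exists_fun {k V : Type} [Field k] [AddCommGroup V] [Module k V] (W : Submodule k V)
    (x : V) (hx : x ∉ W) : ∃ φ : V →ₗ[k] k, φ x = 1 ∧ ∀ w ∈ W, φ w = 0 := by
  obtain ⟨f, hf, hW⟩ := Submodule.exists_le_ker_of_notMem hx
  refine ⟨(f x)⁻¹ • f, ?_, fun w hw => ?_⟩
  · simp [hf]
  · have : f w = 0 := hW hw
    simp [this]

variable {X Y : Type} [LinearOrder X] [LinearOrder Y] [Finite X] [Finite Y]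

theorem isRect_Icc {X Y : Type} [Preorder X] [Preorder Y] (p q : X × Y) (h : p ≤ q) :
    IsRectangle (Icc p q) :=
  ⟨⟨p, le_refl _, h⟩, Icc p.1 q.1, Icc p.2 q.2, ordConnected_Icc, ordConnected_Icc, by
    rw [Icc_prod_eq]⟩

theorem bot_corner {k : Type} [Field k]
    (M : PersistenceModule k (X × Y)) (hwe : WeaklyExact k M) (hindec : Indecomposable M)
    (x0 : X) (y0 : Y) (hx0 : ∀ x, x0 ≤ x) (hy0 : ∀ y, y0 ≤ y)
    (hnt : ¬ Subsingleton (fiber M (x0, y0))) :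
    ∃ (R : Set (X × Y)) (hR : IsRectangle R), Nonempty (M ≅ indicator k R hR.ordConnected) := by
  have : Nontrivial (fiber M (x0, y0)) := not_subsingleton_iff_nontrivial.1 hnt
  have hA0 : ∀ x, ((x0, y0) : X × Y) ≤ (x, y0) := fun x => ⟨hx0 x, le_refl _⟩
  have hB0 : ∀ y, ((x0, y0) : X × Y) ≤ (x0, y) := fun y => ⟨le_refl _, hy0 y⟩
  have hC0 : ∀ t : X × Y, ((x0, y0) : X × Y) ≤ t := fun t => ⟨hx0 _, hy0 _⟩
  let A : X → Submodule k (fiber M (x0, y0)) := fun x => LinearMap.ker (rho k M (hA0 x))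
  let B : Y → Submodule k (fiber M (x0, y0)) := fun y => LinearMap.ker (rho k M (hB0 y))
  have hK : ∀ t : X × Y, LinearMap.ker (rho k M (hC0 t)) = A t.1 ⊔ B t.2 :=
    fun t => (hwe (x0, y0) t (hC0 t)).2
  have hBm : Monotone B := by
    intro y y' h v hv
    have h' : ((x0, y) : X × Y) ≤ (x0, y') := ⟨le_refl _, h⟩
    rw [LinearMap.mem_ker] at hv ⊢
    rw [← rho_comp M (hB0 y) h', hv, map_zero]
  have hAb : A x0 = ⊥ := by
    rw [eq_bot_iff]; intro v hv
    rw [LinearMap.mem_ker, rho_refl] at hv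
    exact hv
  have hBb : B y0 = ⊥ := by
    rw [eq_bot_iff]; intro v hv
    rw [LinearMap.mem_ker, rho_refl] at hv
    exact hv
  obtain ⟨a, ha, ham⟩ := Set.exists_max_image {x | A x ≠ ⊤} id (Set.toFinite _)
    ⟨x0, by simp [hAb]⟩
  obtain ⟨b, hb, hbm⟩ := Set.exists_max_image {y | A a ⊔ B y ≠ ⊤} id (Set.toFinite _)
    ⟨y0, by simpa [hBb] using ha⟩
  have hx : ∃ x, x ∉ A a ⊔ B b ∧ ∀ d, b < d → x ∈ B d := by
    by_cases hd : ∃ d, b < d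
    · obtain ⟨d, hd, hdm⟩ := Set.exists_min_image {d | b < d} id (Set.toFinite _) hd
      have hT : A a ⊔ B d = ⊤ := by
        by_contra h
        exact absurd (hbm d h) (not_le.2 hd)
      have : ¬ B d ≤ A a ⊔ B b := fun h => hb (eq_top_iff.2 (hT ▸ sup_le le_sup_left h))
      obtain ⟨x, hx, hx'⟩ := SetLike.not_le_iff_exists.1 this
      exact ⟨x, hx', fun e he => hBm (hdm e he) hx⟩
    · have : ¬ ⊤ ≤ A a ⊔ B b := fun h => hb (eq_top_iff.2 h)
      obtain ⟨x, hx, hx'⟩ := SetLike.not_le_iff_exists.1 this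
      exact ⟨x, hx', fun e he => absurd ⟨e, he⟩ hd⟩
  obtain ⟨x, hxn, hxB⟩ := hx
  have hne : rho k M (hC0 (a, b)) x ∉ (⊥ : Submodule k (fiber M (a, b))) := by
    intro h
    exact hxn ((hK (a, b)) ▸ (LinearMap.mem_ker.2 h))
  obtain ⟨φ, hφ, -⟩ := exists_fun _ _ hne
  refine ⟨Icc (x0, y0) (a, b), isRect_Icc _ _ (hC0 _), ?_⟩
  refine iso_of_pair hindec (x0, y0) (a, b) (hC0 _) x φ ?_ ?_ hφ _ _ (fun t => Iff.rfl)
  · intro t ht htn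
    rw [← LinearMap.mem_ker, hK t]
    by_cases h : t.1 ≤ a
    · have h' : b < t.2 := not_le.1 fun h' => htn ⟨h, h'⟩
      exact (le_sup_right : _ ≤ A t.1 ⊔ B t.2) (hxB _ h')
    · have : A t.1 = ⊤ := by
        by_contra h'
        exact h (ham _ h')
      rw [this]; simp
  · intro t ht h; exact absurd (hC0 t) h

theorem top_corner {k : Type} [Field k]
    (M : PersistenceModule k (X × Y)) (hwe : WeaklyExact k M) (hindec : Indecomposable M)
    (x0 : X) (y0 : Y) (hx0 : ∀ x, x ≤ x0) (hy0 : ∀ y, y ≤ y0)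
    (hnt : ¬ Subsingleton (fiber M (x0, y0))) :
    ∃ (R : Set (X × Y)) (hR : IsRectangle R), Nonempty (M ≅ indicator k R hR.ordConnected) := by
  have : Nontrivial (fiber M (x0, y0)) := not_subsingleton_iff_nontrivial.1 hnt
  have hA0 : ∀ x, ((x, y0) : X × Y) ≤ (x0, y0) := fun x => ⟨hx0 x, le_refl _⟩
  have hB0 : ∀ y, ((x0, y) : X × Y) ≤ (x0, y0) := fun y => ⟨le_refl _, hy0 y⟩
  have hC0 : ∀ t : X × Y, t ≤ ((x0, y0) : X × Y) := fun t => ⟨hx0 _, hy0 _⟩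
  let A : X → Submodule k (fiber M (x0, y0)) := fun x => LinearMap.range (rho k M (hA0 x))
  let B : Y → Submodule k (fiber M (x0, y0)) := fun y => LinearMap.range (rho k M (hB0 y))
  have hK : ∀ t : X × Y, LinearMap.range (rho k M (hC0 t)) = B t.2 ⊓ A t.1 :=
    fun t => (hwe t (x0, y0) (hC0 t)).1
  have hBm : Monotone B := by
    rintro y y' h _ ⟨v, rfl⟩
    have h' : ((x0, y) : X × Y) ≤ (x0, y') := ⟨le_refl _, h⟩
    exact ⟨rho k M h' v, rho_comp M h' (hB0 y') v⟩
  have hAb : A x0 = ⊤ := by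
    rw [eq_top_iff]; intro v _
    exact ⟨v, rho_refl M _ v⟩
  have hBb : B y0 = ⊤ := by
    rw [eq_top_iff]; intro v _
    exact ⟨v, rho_refl M _ v⟩
  obtain ⟨a, ha, ham⟩ := Set.exists_min_image {x | A x ≠ ⊥} id (Set.toFinite _)
    ⟨x0, by simp [hAb]⟩
  obtain ⟨b, hb, hbm⟩ := Set.exists_min_image {y | B y ⊓ A a ≠ ⊥} id (Set.toFinite _)
    ⟨y0, by simpa [hBb] using ha⟩
  obtain ⟨z, hz, hz0⟩ := Submodule.exists_mem_ne_zero_of_ne_bot hb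
  obtain ⟨y, rfl⟩ : z ∈ LinearMap.range (rho k M (hC0 (a, b))) := by rw [hK]; exact hz
  have hW : ∃ W : Submodule k (fiber M (x0, y0)), rho k M (hC0 (a, b)) y ∉ W ∧
      ∀ d, d < b → B d ≤ W := by
    by_cases hd : ∃ d, d < b
    · obtain ⟨d, hd, hdm⟩ := Set.exists_max_image {d | d < b} id (Set.toFinite _) hd
      have hT : B d ⊓ A a = ⊥ := by
        by_contra h
        exact absurd (hbm d h) (not_le.2 hd)
      refine ⟨B d, fun h => hz0 ?_, fun e he => hBm (hdm e he)⟩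
      have : _ ∈ B d ⊓ A a := ⟨h, hz.2⟩
      rw [hT] at this
      exact this
    · exact ⟨⊥, hz0, fun e he => absurd ⟨e, he⟩ hd⟩
  obtain ⟨W, hyW, hW⟩ := hW
  obtain ⟨φ, hφ, hφW⟩ := exists_fun _ _ hyW
  refine ⟨Icc (a, b) (x0, y0), isRect_Icc _ _ (hC0 _), ?_⟩
  refine iso_of_pair hindec (a, b) (x0, y0) (hC0 _) y φ ?_ ?_ hφ _ _ (fun t => Iff.rfl)
  · intro t ht h; exact absurd (hC0 t) h
  · intro t ht htn v
    have hv : rho k M ht v ∈ B t.2 ⊓ A t.1 := by rw [← hK]; exact ⟨v, rfl⟩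
    by_cases h : a ≤ t.1
    · have h' : t.2 < b := not_le.1 fun h' => htn ⟨h, h'⟩
      exact hφW _ (hW _ h' hv.1)
    · have hb : A t.1 = ⊥ := by
        by_contra h'
        exact h (ham _ h')
      have := hv.2
      rw [hb] at this
      rw [(Submodule.mem_bot k).1 this, map_zero]

end Aux

/-- If `n, m > 1` and `M` is a pfd, weakly exact, indecomposable
persistence module over the grid `[1,n] × [1,m]` not isomorphic to a rectangle module,
then the spaces at the bottom-left and top-right corners are zero. -/
theorem corner_spaces_eq_zero (k : Type) [Field k]
    (n m : ℕ) (hn : 1 < n) (hm : 1 < m)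
    (M : PersistenceModule k (Fin n × Fin m)) (hpfd : Pfd k M)
    (hwe : WeaklyExact k M) (hindec : Indecomposable M)
    (hnotrect : ∀ (R : Set (Fin n × Fin m)) (hR : IsRectangle R),
      IsEmpty (M ≅ indicator k R hR.ordConnected)) :
    Subsingleton (fiber M ((⟨0, by omega⟩ : Fin n), (⟨0, by omega⟩ : Fin m))) ∧
      Subsingleton (fiber M ((⟨n - 1, by omega⟩ : Fin n), (⟨m - 1, by omega⟩ : Fin m))) := by
  constructor
  · by_contra h
    obtain ⟨R, hR, ⟨e⟩⟩ := bot_corner M hwe hindec _ _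
      (fun x => Fin.mk_le_of_le_val (Nat.zero_le _))
      (fun x => Fin.mk_le_of_le_val (Nat.zero_le _)) h
    exact (hnotrect R hR).false e
  · by_contra h
    obtain ⟨R, hR, ⟨e⟩⟩ := top_corner M hwe hindec _ _
      (fun x => Fin.le_def.2 (by have := x.2; simp only; omega))
      (fun x => Fin.le_def.2 (by have := x.2; simp only; omega)) h
    exact (hnotrect R hR).false e

end PersistencePaper
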